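/- arXiv:1808.09584 — 2 statements merged into one kernel-verified Lean document; each statement's English description precedes it below -/
import Mathlib

section
/- Let X be a decomposable continuum that is irreducible between points p and q, and set C = X \ κ(q) and D = X \ κ(p). Then exactly one of C and D is nonempty and closed if and only if NB(F₁(X)) has exactly one element; moreover, in that case NB(F₁(X)) consists precisely of that one of C, D which is nonempty and closed. -/
open Set Filter Metric

/-- `B` does not block `x`: the union of all subcontinua of `X` containing `x`
and contained in the complement of `B` is dense. -/
def NotBlocks {X : Type*} [TopologicalSpace X] (B : Set X) (x : X) : Prop :=
  Dense (⋃₀ {K : Set X | IsCompact K ∧ IsConnected K ∧ x ∈ K ∧ K ⊆ Bᶜ})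

/-- The hyperspace `NB(F₁(X))`: nonempty proper closed subsets that do not block
any point of their complement. -/
def NB (X : Type*) [TopologicalSpace X] : Set (Set X) :=
  {B | B.Nonempty ∧ B ≠ univ ∧ IsClosed B ∧ ∀ x ∉ B, NotBlocks B x}

/-- The hyperspace `NB*(F₁(X))`: nonempty proper closed subsets that do not block
at least one point of their complement. -/
def NBstar (X : Type*) [TopologicalSpace X] : Set (Set X) :=
  {B | B.Nonempty ∧ B ≠ univ ∧ IsClosed B ∧ ∃ x ∉ B, NotBlocks B x}

/-- `F₁(X)`: the one-point subsets of `X`. -/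
def F1 (X : Type*) [TopologicalSpace X] : Set (Set X) :=
  {A | ∃ x : X, A = {x}}

/-- `NWC(X)`: nonempty proper closed subsets with empty interior that are
non-weak cut sets. -/
def NWC (X : Type*) [TopologicalSpace X] : Set (Set X) :=
  {A | A.Nonempty ∧ A ≠ univ ∧ IsClosed A ∧ interior A = ∅ ∧
    ∀ x ∉ A, ∀ y ∉ A, ∃ K : Set X, IsCompact K ∧ IsConnected K ∧ K ⊆ Aᶜ ∧ x ∈ K ∧ y ∈ K}

/-- A shore set: a nonempty proper closed subset `A` such that some sequence of
subcontinua contained in the complement of `A` converges to `X` in the Hausdorff metric. -/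
def ShoreSet {X : Type*} [MetricSpace X] (A : Set X) : Prop :=
  A.Nonempty ∧ A ≠ univ ∧ IsClosed A ∧
    ∃ C : ℕ → Set X, (∀ n, IsCompact (C n) ∧ IsConnected (C n) ∧ C n ⊆ Aᶜ) ∧
      Tendsto (fun n => hausdorffDist (C n) (univ : Set X)) atTop (nhds 0)

/-- `S(X)`: the collection of all shore sets of `X`. -/
def Shore (X : Type*) [MetricSpace X] : Set (Set X) :=
  {A | ShoreSet A}

/-- The composant of a point `z`: the union of all proper subcontinua containing `z`. -/
def composant {X : Type*} [TopologicalSpace X] (z : X) : Set X :=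
  ⋃₀ {L : Set X | IsCompact L ∧ IsConnected L ∧ L ≠ univ ∧ z ∈ L}

/-- `X` is irreducible between `p` and `q`: no proper subcontinuum contains both. -/
def IrrBetween {X : Type*} [TopologicalSpace X] (p q : X) : Prop :=
  ∀ L : Set X, IsCompact L → IsConnected L → p ∈ L → q ∈ L → L = univ

/-- A subcontinuum `K` is decomposable if it is the union of two proper subcontinua. -/
def DecomposableSet {X : Type*} [TopologicalSpace X] (K : Set X) : Prop :=
  ∃ A B : Set X, IsCompact A ∧ IsConnected A ∧ A ⊆ K ∧ A ≠ K ∧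
    IsCompact B ∧ IsConnected B ∧ B ⊆ K ∧ B ≠ K ∧ A ∪ B = K

/-- `s(x)` relative to the point `p`: the union of all subcontinua containing `x`
and contained in `X \ {p}`. -/
def sComp {X : Type*} [TopologicalSpace X] (p x : X) : Set X :=
  ⋃₀ {K : Set X | IsCompact K ∧ IsConnected K ∧ x ∈ K ∧ K ⊆ ({p} : Set X)ᶜ}

theorem IrrBetween.symm {X : Type*} [TopologicalSpace X] {p q : X} (h : IrrBetween p q) :
    IrrBetween q p :=
  fun L hL hL' hq hp => h L hL hL' hp hq

/-- The union of a connected set `L` and one piece of a separation of its complement is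
connected. -/
theorem isPreconnected_union_of_compl_eq {X : Type*} [TopologicalSpace X] [PreconnectedSpace X]
    {L U V : Set X} (hL : IsConnected L) (hU : IsOpen U) (hV : IsOpen V)
    (hUV : Disjoint U V) (hLUV : Lᶜ = U ∪ V) : IsPreconnected (L ∪ U) := by
  have hVc : L ∪ U = Vᶜ := by
    ext x
    have h1 : x ∈ Lᶜ ↔ x ∈ U ∪ V := by rw [hLUV]
    have h2 : x ∈ U → x ∉ V := fun a b => disjoint_left.1 hUV a b
    simp only [mem_compl_iff, mem_union] at *
    tauto
  have hUc : L ∪ V = Uᶜ := by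
    ext x
    have h1 : x ∈ Lᶜ ↔ x ∈ U ∪ V := by rw [hLUV]
    have h2 : x ∈ U → x ∉ V := fun a b => disjoint_left.1 hUV a b
    simp only [mem_compl_iff, mem_union] at *
    tauto
  have hclU : IsClosed (L ∪ U) := hVc ▸ hV.isClosed_compl
  have hclV : IsClosed (L ∪ V) := hUc ▸ hU.isClosed_compl
  have key : ∀ F G : Set X, IsClosed F → IsClosed G → L ∪ U ⊆ F ∪ G →
      (L ∪ U) ∩ (F ∩ G) = ∅ → L ⊆ F → L ∪ U ⊆ F := by
    intro F G hF hG hsub hdisj hLF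
    have hdisj' : ∀ x, x ∈ L ∪ U → x ∈ F → x ∉ G := fun x hx hxF hxG =>
      (eq_empty_iff_forall_notMem.1 hdisj x) ⟨hx, hxF, hxG⟩
    have hcompl : (G ∩ (L ∪ U))ᶜ = F ∩ (L ∪ U) ∪ (L ∪ V) := by
      ext x
      have h1 : x ∈ Lᶜ ↔ x ∈ U ∪ V := by rw [hLUV]
      have h2 : x ∈ U → x ∉ V := fun a b => disjoint_left.1 hUV a b
      have h3 := hdisj' x
      have h4 := @hsub x
      have h5 := @hLF x
      simp only [mem_compl_iff, mem_union, mem_inter_iff] at *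
      tauto
    have hclopen : IsClopen (G ∩ (L ∪ U)) :=
      ⟨hG.inter hclU, by
        rw [← isClosed_compl_iff, hcompl]
        exact (hF.inter hclU).union hclV⟩
    rcases isClopen_iff.1 hclopen with h | h
    · intro x hx
      rcases hsub hx with hxF | hxG
      · exact hxF
      · exact absurd (show x ∈ G ∩ (L ∪ U) from ⟨hxG, hx⟩) (by simp [h])
    · obtain ⟨l, hl⟩ := hL.nonempty
      have : l ∈ G ∩ (L ∪ U) := h ▸ mem_univ l
      exact absurd this.1 (hdisj' l (Or.inl hl) (hLF hl))
  rw [isPreconnected_iff_subset_of_disjoint_closed]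
  intro F G hF hG hsub hdisj
  have hLFG : L ∩ (F ∩ G) = ∅ :=
    subset_empty_iff.1 (hdisj ▸ inter_subset_inter_left _ subset_union_left)
  rcases isPreconnected_iff_subset_of_disjoint_closed.1 hL.isPreconnected F G hF hG
      (subset_union_left.trans hsub) hLFG with h | h
  · exact Or.inl (key F G hF hG hsub hdisj h)
  · exact Or.inr (key G F hG hF (union_comm F G ▸ hsub) (inter_comm F G ▸ hdisj) h)

section Irreducible

variable {X : Type*} [TopologicalSpace X] [CompactSpace X] {p q : X}

/-- In a continuum irreducible between `p` and `q`, the complement of a proper subcontinuum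
containing `p` is connected. -/
theorem IrrBetween.isPreconnected_compl [ConnectedSpace X] (h : IrrBetween p q) {L : Set X}
    (hLne : L ≠ univ) (hLc : IsClosed L) (hL : IsConnected L) (hp : p ∈ L) :
    IsPreconnected Lᶜ := by
  have hq : q ∈ Lᶜ := fun hq => hLne (h L hLc.isCompact hL hp hq)
  have key : ∀ U V : Set X, IsOpen U → IsOpen V → Lᶜ ⊆ U ∪ V → Lᶜ ∩ (U ∩ V) = ∅ →
      q ∈ U → Lᶜ ⊆ U := by
    intro U V hU hV hsub hdisj hqU
    have hd : Disjoint (U ∩ Lᶜ) (V ∩ Lᶜ) := by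
      rw [Set.disjoint_left]
      rintro x ⟨h1, h2⟩ ⟨h3, -⟩
      exact (eq_empty_iff_forall_notMem.1 hdisj x) ⟨h2, h1, h3⟩
    have he : Lᶜ = U ∩ Lᶜ ∪ V ∩ Lᶜ := by
      rw [← union_inter_distrib_right, inter_eq_right.2 hsub]
    have hU' : IsOpen (U ∩ Lᶜ) := hU.inter hLc.isOpen_compl
    have hV' : IsOpen (V ∩ Lᶜ) := hV.inter hLc.isOpen_compl
    have hpre := isPreconnected_union_of_compl_eq hL hU' hV' hd he
    have hcl : IsClosed (L ∪ U ∩ Lᶜ) := by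
      have : L ∪ U ∩ Lᶜ = (V ∩ Lᶜ)ᶜ := by
        ext x
        have h1 := @hsub x
        have h2 := eq_empty_iff_forall_notMem.1 hdisj x
        simp only [mem_compl_iff, mem_union, mem_inter_iff] at *
        tauto
      exact this ▸ hV'.isClosed_compl
    have huniv := h (L ∪ U ∩ Lᶜ) hcl.isCompact ⟨⟨p, Or.inl hp⟩, hpre⟩ (Or.inl hp)
      (Or.inr ⟨hqU, hq⟩)
    intro x hx
    rcases (huniv ▸ mem_univ x : x ∈ L ∪ U ∩ Lᶜ) with hxL | hxU
    · exact absurd hxL hx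
    · exact hxU.1
  rw [isPreconnected_iff_subset_of_disjoint]
  intro U V hU hV hsub hdisj
  rcases hsub hq with hqU | hqV
  · exact Or.inl (key U V hU hV hsub hdisj hqU)
  · exact Or.inr (key V U hV hU (union_comm U V ▸ hsub) (inter_comm U V ▸ hdisj) hqV)

/-- If a subcontinuum through `p` leaves a proper subcontinuum `L` through `p`, then it contains
everything outside `closure Lᶜ`. -/
theorem IrrBetween.mem_of_notMem_closure_compl [ConnectedSpace X] (h : IrrBetween p q)
    {K L : Set X} (hLne : L ≠ univ) (hLc : IsClosed L) (hL : IsConnected L) (hpL : p ∈ L)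
    (hK : IsConnected K) (hKc : IsClosed K) (hp : p ∈ K) (hKL : (K ∩ Lᶜ).Nonempty)
    {e : X} (he : e ∉ closure Lᶜ) : e ∈ K := by
  obtain ⟨x, hxK, hxL⟩ := hKL
  have hq : q ∈ Lᶜ := fun hq => hLne (h L hLc.isCompact hL hpL hq)
  have huniv : K ∪ closure Lᶜ = univ :=
    h _ (hKc.union isClosed_closure).isCompact
      (hK.union ⟨x, hxK, subset_closure hxL⟩
        ⟨⟨q, subset_closure hq⟩, (h.isPreconnected_compl hLne hLc hL hpL).closure⟩)
      (Or.inl hp) (Or.inr (subset_closure hq))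
  exact (huniv ▸ mem_univ e : e ∈ K ∪ closure Lᶜ).resolve_right he

theorem mem_composant {L : Set X} {x z : X} (hLc : IsClosed L) (hL : IsConnected L)
    (hLne : L ≠ univ) (hz : z ∈ L) (hx : x ∈ L) : x ∈ composant z :=
  mem_sUnion.2 ⟨L, ⟨hLc.isCompact, hL, hLne, hz⟩, hx⟩

end Irreducible

theorem IrrBetween.notMem_composant {X : Type*} [TopologicalSpace X] {p q : X}
    (h : IrrBetween p q) : q ∉ composant p := by
  rintro ⟨L, ⟨hLc, hL, hLne, hp⟩, hq⟩
  exact hLne (h L hLc hL hp hq)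

theorem DecomposableSet.exists_cover {X : Type*} [TopologicalSpace X] {p q : X}
    (hdec : DecomposableSet (univ : Set X)) (h : IrrBetween p q) :
    ∃ A B : Set X, IsCompact A ∧ IsConnected A ∧ A ≠ univ ∧ p ∈ A ∧
      IsCompact B ∧ IsConnected B ∧ B ≠ univ ∧ q ∈ B ∧ A ∪ B = univ := by
  obtain ⟨A, B, hAc, hA, -, hAne, hBc, hB, -, hBne, hAB⟩ := hdec
  rcases (hAB ▸ mem_univ p : p ∈ A ∪ B) with hpA | hpB
  · have hqB : q ∈ B := (hAB ▸ mem_univ q : q ∈ A ∪ B).resolve_left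
      fun hq => hAne (h A hAc hA hpA hq)
    exact ⟨A, B, hAc, hA, hAne, hpA, hBc, hB, hBne, hqB, hAB⟩
  · have hqA : q ∈ A := (hAB ▸ mem_univ q : q ∈ A ∪ B).resolve_right
      fun hq => hBne (h B hBc hB hpB hq)
    exact ⟨B, A, hBc, hB, hBne, hpB, hAc, hA, hAne, hqA, union_comm A B ▸ hAB⟩

theorem NotBlocks.exists_subcontinuum {X : Type*} [TopologicalSpace X] {E U : Set X} {x : X}
    (h : NotBlocks E x) (hU : IsOpen U) (hUne : U.Nonempty) :
    ∃ K : Set X, IsCompact K ∧ IsConnected K ∧ x ∈ K ∧ K ⊆ Eᶜ ∧ (K ∩ U).Nonempty := by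
  obtain ⟨y, hyU, K, ⟨hKc, hK, hxK, hKE⟩, hyK⟩ := h.inter_open_nonempty U hU hUne
  exact ⟨K, hKc, hK, hxK, hKE, y, hyK, hyU⟩

theorem interior_eq_empty_of_mem_NB {X : Type*} [TopologicalSpace X] {E : Set X}
    (hE : E ∈ NB X) : interior E = ∅ := by
  obtain ⟨-, hne, -, hnb⟩ := hE
  obtain ⟨x, hx⟩ := (ne_univ_iff_exists_notMem E).1 hne
  rw [interior_eq_empty_iff_dense_compl]
  exact (hnb x hx).mono (sUnion_subset fun K hK => hK.2.2.2)

/-- In a decomposable continuum, any point outside `composant q` and any point outside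
`composant p` are again points of irreducibility. -/
theorem IrrBetween.of_notMem_composant {X : Type*} [MetricSpace X] [CompactSpace X] {p q : X}
    (h : IrrBetween p q)
    (hdec : DecomposableSet (univ : Set X)) {c d : X} (hc : c ∉ composant q)
    (hd : d ∉ composant p) : IrrBetween c d := by
  obtain ⟨A, B, hAc, hA, hAne, hpA, hBc, hB, hBne, hqB, hAB⟩ := hdec.exists_cover h
  intro L hLc hL hcL hdL
  have hcA : c ∈ A := (hAB ▸ mem_univ c : c ∈ A ∪ B).resolve_right
    fun hcB => hc (mem_composant hBc.isClosed hB hBne hqB hcB)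
  have hAL : A ∪ L = univ := by
    by_contra hne
    exact hd (mem_composant (hAc.union hLc).isClosed (hA.union ⟨c, hcA, hcL⟩ hL) hne
      (Or.inl hpA) (Or.inr hdL))
  have hqL : q ∈ L := (hAL ▸ mem_univ q : q ∈ A ∪ L).resolve_left
    fun hqA => hAne (h A hAc hA hpA hqA)
  by_contra hne
  exact hc (mem_composant hLc.isClosed hL hne hqL hcL)

/-- If the union of `X \ κ(q)` and `X \ κ(p)` is closed, then so is the first of them. -/
theorem IrrBetween.isClosed_of_isClosed_union {X : Type*} [MetricSpace X] [CompactSpace X]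
    {p q : X} (h : IrrBetween p q)
    (hdec : DecomposableSet (univ : Set X))
    (hcl : IsClosed ((composant q)ᶜ ∪ (composant p)ᶜ)) : IsClosed (composant q)ᶜ := by
  obtain ⟨A, B, hAc, hA, hAne, hpA, hBc, hB, hBne, hqB, hAB⟩ := hdec.exists_cover h
  have heq : (composant q)ᶜ = ((composant q)ᶜ ∪ (composant p)ᶜ) ∩ A := by
    ext x
    have h1 : x ∈ A → x ∈ composant p := mem_composant hAc.isClosed hA hAne hpA
    have h2 : x ∈ B → x ∈ composant q := mem_composant hBc.isClosed hB hBne hqB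
    have h3 : x ∈ A ∨ x ∈ B := (hAB ▸ mem_univ x : x ∈ A ∪ B)
    simp only [mem_compl_iff, mem_union, mem_inter_iff]
    tauto
  exact heq ▸ hcl.inter hAc.isClosed

/-- A composant is a countable union of proper subcontinua. -/
theorem exists_countable_composant_cover {X : Type*} [MetricSpace X] [CompactSpace X] (z : X) :
    ∃ S : Set (Set X), S.Countable ∧
      (∀ M ∈ S, IsCompact M ∧ IsConnected M ∧ M ≠ univ ∧ z ∈ M) ∧ composant z ⊆ ⋃₀ S := by
  refine ⟨(fun U : Set X => connectedComponentIn Uᶜ z) ''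
    {U ∈ TopologicalSpace.countableBasis X | z ∉ U},
    ((TopologicalSpace.countable_countableBasis X).mono (sep_subset _ _)).image _, ?_, ?_⟩
  · rintro _ ⟨U, ⟨hUb, hzU⟩, rfl⟩
    have hUo := TopologicalSpace.isOpen_of_mem_countableBasis hUb
    obtain ⟨u, hu⟩ := TopologicalSpace.nonempty_of_mem_countableBasis hUb
    have hcl : IsClosed (connectedComponentIn Uᶜ z) := isClosed_of_closure_subset <|
      isPreconnected_connectedComponentIn.closure.subset_connectedComponentIn
        (subset_closure (mem_connectedComponentIn hzU))
        (closure_minimal (connectedComponentIn_subset _ _) hUo.isClosed_compl)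
    refine ⟨hcl.isCompact, isConnected_connectedComponentIn_iff.2 hzU, fun huniv => ?_, mem_connectedComponentIn hzU⟩
    exact connectedComponentIn_subset Uᶜ z (eq_univ_iff_forall.1 huniv u) hu
  · rintro x ⟨L, ⟨hLc, hL, hLne, hzL⟩, hxL⟩
    obtain ⟨y, hy⟩ := nonempty_compl.2 hLne
    obtain ⟨U, hUb, -, hUL⟩ := (TopologicalSpace.isBasis_countableBasis X).exists_subset_of_mem_open
      hy hLc.isClosed.isOpen_compl
    exact ⟨_, ⟨U, ⟨hUb, fun hzU => hUL hzU hzL⟩, rfl⟩,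
      hL.isPreconnected.subset_connectedComponentIn hzL (subset_compl_comm.1 hUL) hxL⟩

section MetricContinuum

variable {X : Type*} [MetricSpace X] [CompactSpace X] [ConnectedSpace X] {p q : X}

/-- A member of `NB X` contains one of any two points of irreducibility. -/
theorem IrrBetween.mem_or_mem_of_mem_NB (h : IrrBetween p q)
    (hdec : DecomposableSet (univ : Set X)) {E : Set X} (hE : E ∈ NB X) : p ∈ E ∨ q ∈ E := by
  by_contra! hpq
  obtain ⟨A, B, hAc, hA, hAne, hpA, hBc, hB, hBne, hqB, hAB⟩ := hdec.exists_cover h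
  obtain ⟨⟨e, he⟩, -, -, hnb⟩ := hE
  obtain ⟨K, hKc, hK, hpK, hKE, hKA⟩ := (hnb p hpq.1).exists_subcontinuum
    hAc.isClosed.isOpen_compl (nonempty_compl.2 hAne)
  obtain ⟨K', hKc', hK', hqK', hKE', y, hyK', hyB⟩ := (hnb q hpq.2).exists_subcontinuum
    hBc.isClosed.isOpen_compl (nonempty_compl.2 hBne)
  have hyA : y ∉ closure Aᶜ := fun hy =>
    hyB (closure_minimal (compl_subset_iff_union.2 hAB) hBc.isClosed hy)
  have hyK : y ∈ K :=
    h.mem_of_notMem_closure_compl hAne hAc.isClosed hA hpA hK hKc.isClosed hpK hKA hyA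
  have huniv : K ∪ K' = univ := h _ (hKc.union hKc') (hK.union ⟨y, hyK, hyK'⟩ hK')
    (Or.inl hpK) (Or.inr hqK')
  rcases (huniv ▸ mem_univ e : e ∈ K ∪ K') with heK | heK
  · exact hKE heK he
  · exact hKE' heK he

/-- If the complement of `composant q` is covered by a closed set with empty interior, then each
point of `composant q` is interior to a proper subcontinuum through `q`. -/
theorem IrrBetween.exists_notMem_closure_compl (h : IrrBetween p q) {E : Set X}
    (hEc : IsClosed E) (hE : interior E = ∅) (hqE : (composant q)ᶜ ⊆ E) {e : X}
    (he : e ∈ composant q) :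
    ∃ M : Set X, IsCompact M ∧ IsConnected M ∧ M ≠ univ ∧ q ∈ M ∧ e ∉ closure Mᶜ := by
  by_contra! hcon
  obtain ⟨L, ⟨hLc, hL, hLne, hqL⟩, heL⟩ := he
  obtain ⟨S, hScount, hS, hScover⟩ := exists_countable_composant_cover q
  have hLM : ∀ M ∈ S, Lᶜ ⊆ closure Mᶜ := by
    intro M hM
    obtain ⟨hMc, hMconn, hMne, hqM⟩ := hS M hM
    have hpM : p ∈ Mᶜ := fun hpM => hMne (h M hMc hMconn hpM hqM)
    have huniv : L ∪ closure Mᶜ = univ :=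
      h _ (hLc.union isClosed_closure.isCompact)
        (hL.union ⟨e, heL, hcon M hMc hMconn hMne hqM⟩ ⟨⟨p, subset_closure hpM⟩,
          (h.symm.isPreconnected_compl hMne hMc.isClosed hMconn hqM).closure⟩)
        (Or.inr (subset_closure hpM)) (Or.inl hqL)
    exact compl_subset_iff_union.2 huniv
  have hdense : Dense (⋃ M ∈ insert E S, interior M) := by
    refine dense_biUnion_interior_of_closed (f := id) ?_ (hScount.insert E) ?_
    · rintro M (rfl | hM)
      · exact hEc
      · exact (hS M hM).1.isClosed
    · refine eq_univ_of_forall fun x => ?_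
      by_cases hx : x ∈ composant q
      · obtain ⟨M, hM, hxM⟩ := hScover hx
        exact mem_biUnion (mem_insert_of_mem E hM) hxM
      · exact mem_biUnion (mem_insert E S) (hqE hx)
  obtain ⟨x, hxL, hx⟩ := hdense.inter_open_nonempty _ hLc.isClosed.isOpen_compl
    (nonempty_compl.2 hLne)
  obtain ⟨M, hM, hxM⟩ := mem_iUnion₂.1 hx
  rcases hM with rfl | hM
  · exact (hE ▸ hxM : x ∈ (∅ : Set X))
  · have := hLM M hM hxL
    rw [closure_compl] at this
    exact this hxM

/-- A member of `NB X` which contains `X \ κ(q)` but not all of `X \ κ(p)` is `X \ κ(q)`. -/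
theorem IrrBetween.eq_compl_composant_of_mem_NB (h : IrrBetween p q)
    (hdec : DecomposableSet (univ : Set X)) {E : Set X} (hE : E ∈ NB X)
    (hqE : (composant q)ᶜ ⊆ E) (hpE : ¬(composant p)ᶜ ⊆ E) : E = (composant q)ᶜ := by
  refine Subset.antisymm (fun e he heq => ?_) hqE
  obtain ⟨d, hd, hdE⟩ := not_subset.1 hpE
  obtain ⟨A, B, hAc, hA, hAne, hpA, hBc, hB, hBne, hqB, hAB⟩ := hdec.exists_cover h
  obtain ⟨M, hMc, hM, hMne, hqM, heM⟩ :=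
    h.exists_notMem_closure_compl hE.2.2.1 (interior_eq_empty_of_mem_NB hE) hqE heq
  have hdB : d ∈ B := (hAB ▸ mem_univ d : d ∈ A ∪ B).resolve_left
    fun hdA => hd (mem_composant hAc.isClosed hA hAne hpA hdA)
  have hBM : B ∪ M ≠ univ := fun huniv => by
    rcases (huniv ▸ mem_univ p : p ∈ B ∪ M) with hp | hp
    · exact hBne (h B hBc hB hp hqB)
    · exact hMne (h M hMc hM hp hqM)
  have hBMc := (hBc.union hMc).isClosed
  obtain ⟨K, hKc, hK, hdK, hKE, hKM⟩ := (hE.2.2.2 d hdE).exists_subcontinuum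
    hBMc.isOpen_compl (nonempty_compl.2 hBM)
  have hpd : IrrBetween d p := (h.of_notMem_composant hdec h.symm.notMem_composant hd).symm
  refine hKE (hpd.mem_of_notMem_closure_compl hBM hBMc (hB.union ⟨q, hqB, hqM⟩ hM) (Or.inl hdB)
    hK hKc.isClosed hdK hKM fun he' => heM ?_) he
  exact closure_mono (compl_subset_compl.2 subset_union_right) he'

/-- A member of `NB X` which contains both `X \ κ(q)` and `X \ κ(p)` is their union. -/
theorem IrrBetween.eq_union_of_mem_NB (h : IrrBetween p q) {E : Set X} (hE : E ∈ NB X)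
    (hqE : (composant q)ᶜ ⊆ E) (hpE : (composant p)ᶜ ⊆ E) :
    E = (composant q)ᶜ ∪ (composant p)ᶜ := by
  refine Subset.antisymm (fun e he => ?_) (union_subset hqE hpE)
  by_contra hcon
  simp only [mem_union, mem_compl_iff, not_or, not_not] at hcon
  have hint := interior_eq_empty_of_mem_NB hE
  obtain ⟨M, hMc, hM, hMne, hqM, heM⟩ :=
    h.exists_notMem_closure_compl hE.2.2.1 hint hqE hcon.1
  obtain ⟨L, hLc, hL, hLne, hpL, heL⟩ :=
    h.symm.exists_notMem_closure_compl hE.2.2.1 hint hpE hcon.2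
  obtain ⟨x, hx⟩ := (ne_univ_iff_exists_notMem E).1 hE.2.1
  obtain ⟨K₁, hKc₁, hK₁, hxK₁, hKE₁, y, hyK, hyM⟩ := (hE.2.2.2 x hx).exists_subcontinuum
    hMc.isClosed.isOpen_compl (nonempty_compl.2 hMne)
  obtain ⟨K₂, hKc₂, hK₂, hxK₂, hKE₂, z, hzK, hzL⟩ := (hE.2.2.2 x hx).exists_subcontinuum
    hLc.isClosed.isOpen_compl (nonempty_compl.2 hLne)
  have hpM : p ∈ closure Mᶜ := subset_closure fun hp => hMne (h M hMc hM hp hqM)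
  have hqL : q ∈ closure Lᶜ := subset_closure fun hq => hLne (h L hLc hL hpL hq)
  have hMconn : IsConnected (K₁ ∪ closure Mᶜ) := hK₁.union ⟨y, hyK, subset_closure hyM⟩
    ⟨⟨p, hpM⟩, (h.symm.isPreconnected_compl hMne hMc.isClosed hM hqM).closure⟩
  have hLconn : IsConnected (K₂ ∪ closure Lᶜ) := hK₂.union ⟨z, hzK, subset_closure hzL⟩
    ⟨⟨q, hqL⟩, (h.isPreconnected_compl hLne hLc.isClosed hL hpL).closure⟩
  have huniv : (K₁ ∪ closure Mᶜ) ∪ (K₂ ∪ closure Lᶜ) = univ :=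
    h _ ((hKc₁.union isClosed_closure.isCompact).union (hKc₂.union isClosed_closure.isCompact))
      (hMconn.union ⟨x, Or.inl hxK₁, Or.inl hxK₂⟩ hLconn)
      (Or.inl (Or.inr hpM)) (Or.inr (Or.inr hqL))
  rcases (huniv ▸ mem_univ e : e ∈ (K₁ ∪ closure Mᶜ) ∪ (K₂ ∪ closure Lᶜ)) with
    (h1 | h1) | (h1 | h1)
  exacts [hKE₁ h1 he, heM h1, hKE₂ h1 he, heL h1]

/-- If `X \ κ(q)` is closed, then it belongs to `NB X`. -/
theorem IrrBetween.compl_composant_mem_NB (h : IrrBetween p q) (hpq : p ≠ q)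
    (hcl : IsClosed (composant q)ᶜ) : (composant q)ᶜ ∈ NB X := by
  have hpc : p ∉ composant q := h.symm.notMem_composant
  have hqc : q ∈ composant q := by
    refine mem_composant isClosed_singleton isConnected_singleton (fun huniv => hpq ?_)
      (mem_singleton q) (mem_singleton q)
    exact mem_singleton_iff.1 (huniv ▸ mem_univ p)
  have hconn : IsConnected (composant q) :=
    ⟨⟨q, hqc⟩, isPreconnected_sUnion q _ (fun L hL => hL.2.2.2) fun L hL => hL.2.1.isPreconnected⟩
  have hdense : closure (composant q) = univ := by
    by_contra hne
    have hsub : closure (composant q) ⊆ composant q := fun x hx =>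
      mem_composant isClosed_closure hconn.closure hne (subset_closure hqc) hx
    have hclopen : IsClopen (composant q) :=
      ⟨isClosed_of_closure_subset hsub, isClosed_compl_iff.1 hcl⟩
    rcases isClopen_iff.1 hclopen with h0 | h0
    · exact (h0 ▸ hqc : q ∈ (∅ : Set X))
    · exact hpc (h0 ▸ mem_univ p)
  refine ⟨⟨p, hpc⟩, fun huniv => (huniv ▸ mem_univ q : q ∈ (composant q)ᶜ) hqc, hcl, ?_⟩
  intro x hx
  obtain ⟨L, ⟨hLc, hL, hLne, hqL⟩, hxL⟩ := not_not.1 hx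
  refine (dense_iff_closure_eq.2 hdense).mono ?_
  rintro y ⟨M, ⟨hMc, hM, hMne, hqM⟩, hyM⟩
  refine ⟨L ∪ M, ⟨hLc.union hMc, hL.union ⟨q, hqL, hqM⟩ hM, Or.inl hxL, ?_⟩, Or.inr hyM⟩
  rw [compl_compl]
  rintro w (hw | hw)
  · exact mem_composant hLc.isClosed hL hLne hqL hw
  · exact mem_composant hMc.isClosed hM hMne hqM hw

/-- The members of `NB X` are, up to their union, the closed sets among `X \ κ(q)` and
`X \ κ(p)`. -/
theorem IrrBetween.eq_or_of_mem_NB (h : IrrBetween p q) (hdec : DecomposableSet (univ : Set X))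
    {E : Set X} (hE : E ∈ NB X) :
    E = (composant q)ᶜ ∨ E = (composant p)ᶜ ∨
      (IsClosed (composant q)ᶜ ∧ IsClosed (composant p)ᶜ) := by
  by_cases hqE : (composant q)ᶜ ⊆ E <;> by_cases hpE : (composant p)ᶜ ⊆ E
  · have heq := h.eq_union_of_mem_NB hE hqE hpE
    have hcl := heq ▸ hE.2.2.1
    exact Or.inr (Or.inr ⟨h.isClosed_of_isClosed_union hdec hcl,
      h.symm.isClosed_of_isClosed_union hdec (union_comm _ (composant p)ᶜ ▸ hcl)⟩)
  · exact Or.inl (h.eq_compl_composant_of_mem_NB hdec hE hqE hpE)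
  · exact Or.inr (Or.inl (h.symm.eq_compl_composant_of_mem_NB hdec hE hpE hqE))
  · obtain ⟨c, hc, hcE⟩ := not_subset.1 hqE
    obtain ⟨d, hd, hdE⟩ := not_subset.1 hpE
    rcases (h.of_notMem_composant hdec hc hd).mem_or_mem_of_mem_NB hdec hE with h1 | h1
    exacts [absurd h1 hcE, absurd h1 hdE]

end MetricContinuum

theorem stmt10 (X : Type*) [MetricSpace X] [CompactSpace X] [ConnectedSpace X] [Nonempty X]
    (p q : X) (hdec : DecomposableSet (univ : Set X)) (hirr : IrrBetween p q)
    (C D : Set X) (hC : C = (composant q)ᶜ) (hD : D = (composant p)ᶜ) :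
    (Xor' (C.Nonempty ∧ IsClosed C) (D.Nonempty ∧ IsClosed D) ↔ (NB X).ncard = 1) ∧
    (Xor' (C.Nonempty ∧ IsClosed C) (D.Nonempty ∧ IsClosed D) →
      NB X = {E : Set X | (E = C ∨ E = D) ∧ E.Nonempty ∧ IsClosed E}) := by
  have hCne : C.Nonempty := ⟨p, hC ▸ hirr.symm.notMem_composant⟩
  have hDne : D.Nonempty := ⟨q, hD ▸ hirr.notMem_composant⟩
  have hpq : p ≠ q := by
    rintro rfl
    obtain ⟨A, B, hAc, hA, hAne, hpA, -⟩ := hdec.exists_cover hirr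
    exact hAne (hirr A hAc hA hpA hpA)
  have hCD : C ≠ D := by
    obtain ⟨A, B, hAc, hA, hAne, hpA, -⟩ := hdec.exists_cover hirr
    rw [hC, hD]
    intro heq
    have hpD : p ∈ (composant p)ᶜ := heq ▸ hirr.symm.notMem_composant
    exact hpD (mem_composant hAc.isClosed hA hAne hpA hpA)
  have hCNB : IsClosed C → C ∈ NB X := fun hcl =>
    hC ▸ hirr.compl_composant_mem_NB hpq (hC ▸ hcl)
  have hDNB : IsClosed D → D ∈ NB X := fun hcl =>
    hD ▸ hirr.symm.compl_composant_mem_NB hpq.symm (hD ▸ hcl)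
  have hNB : ∀ E ∈ NB X, E = C ∨ E = D ∨ (IsClosed C ∧ IsClosed D) := by
    intro E hE
    rw [hC, hD]
    exact hirr.eq_or_of_mem_NB hdec hE
  have hXor : Xor' (C.Nonempty ∧ IsClosed C) (D.Nonempty ∧ IsClosed D) →
      NB X = {E : Set X | (E = C ∨ E = D) ∧ E.Nonempty ∧ IsClosed E} := by
    intro hx
    have hnot : ¬(IsClosed C ∧ IsClosed D) := by
      rcases hx with ⟨-, h2⟩ | ⟨-, h2⟩
      · exact fun h3 => h2 ⟨hDne, h3.2⟩
      · exact fun h3 => h2 ⟨hCne, h3.1⟩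
    ext E
    constructor
    · intro hE
      refine ⟨?_, hE.1, hE.2.2.1⟩
      rcases hNB E hE with h1 | h1 | h1
      exacts [Or.inl h1, Or.inr h1, absurd h1 hnot]
    · rintro ⟨rfl | rfl, -, hcl⟩
      exacts [hCNB hcl, hDNB hcl]
  refine ⟨⟨fun hx => ?_, fun hcard => ?_⟩, hXor⟩
  · rw [hXor hx, ncard_eq_one]
    rcases hx with ⟨⟨-, hCcl⟩, h2⟩ | ⟨⟨-, hDcl⟩, h2⟩
    · refine ⟨C, Subset.antisymm ?_ (singleton_subset_iff.2 ⟨Or.inl rfl, hCne, hCcl⟩)⟩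
      rintro E ⟨rfl | rfl, hE⟩
      exacts [rfl, absurd hE h2]
    · refine ⟨D, Subset.antisymm ?_ (singleton_subset_iff.2 ⟨Or.inr rfl, hDne, hDcl⟩)⟩
      rintro E ⟨rfl | rfl, hE⟩
      exacts [absurd hE h2, rfl]
  · obtain ⟨E, hE⟩ := ncard_eq_one.1 hcard
    have hEmem : E ∈ NB X := hE ▸ mem_singleton E
    have huniq : ∀ F ∈ NB X, F = E := fun F hF => by rwa [hE] at hF
    by_cases hCcl : IsClosed C <;> by_cases hDcl : IsClosed D
    · exact absurd ((huniq C (hCNB hCcl)).trans (huniq D (hDNB hDcl)).symm) hCD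
    · exact Or.inl ⟨⟨hCne, hCcl⟩, fun h2 => hDcl h2.2⟩
    · exact Or.inr ⟨⟨hDne, hDcl⟩, fun h2 => hCcl h2.2⟩
    · rcases hNB E hEmem with rfl | rfl | h1
      exacts [absurd hEmem.2.2.1 hCcl, absurd hEmem.2.2.1 hDcl, absurd h1.1 hCcl]
end

section
/- Let X be a continuum such that every singleton {x} belongs to NB(F₁(X)), and suppose there exists p ∈ X with {p} ∉ NWC(X). For x ∈ X \ {p}, let s(x) be the union of all subcontinua of X that contain x and are contained in X \ {p}. Then the family {s(x) : x ∈ X \ {p}} is a partition of X \ {p} (any two members are either equal or disjoint, and every point of X \ {p} lies in some member), and this family has uncountably many distinct members. -/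
open Set Filter Metric

section SComp

variable {X : Type*} [TopologicalSpace X] {p x y : X}

theorem mem_sComp_self (hx : x ≠ p) : x ∈ sComp p x :=
  ⟨{x}, ⟨isCompact_singleton, isConnected_singleton, rfl, by simpa using hx.symm⟩, rfl⟩

theorem sComp_subset_of_mem (h : y ∈ sComp p x) : sComp p y ⊆ sComp p x := by
  rintro z ⟨L, ⟨hLc, hL, hyL, hLp⟩, hzL⟩
  obtain ⟨K, ⟨hKc, hK, hxK, hKp⟩, hyK⟩ := h
  exact ⟨K ∪ L, ⟨hKc.union hLc, hK.union ⟨y, hyK, hyL⟩ hL, Or.inl hxK, union_subset hKp hLp⟩,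
    Or.inr hzL⟩

theorem mem_sComp_symm (h : y ∈ sComp p x) : x ∈ sComp p y := by
  obtain ⟨K, ⟨hKc, hK, hxK, hKp⟩, hyK⟩ := h
  exact ⟨K, ⟨hKc, hK, hyK, hKp⟩, hxK⟩

theorem sComp_eq_of_mem (h : y ∈ sComp p x) : sComp p y = sComp p x :=
  (sComp_subset_of_mem h).antisymm (sComp_subset_of_mem (mem_sComp_symm h))

theorem sComp_eq_or_disjoint (p x y : X) :
    sComp p x = sComp p y ∨ sComp p x ∩ sComp p y = ∅ := by
  refine or_iff_not_imp_right.2 fun h => ?_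
  obtain ⟨z, hzx, hzy⟩ := nonempty_iff_ne_empty.2 h
  exact (sComp_eq_of_mem hzx).symm.trans (sComp_eq_of_mem hzy)

end SComp

theorem isClosed_connectedComponentIn {X : Type*} [TopologicalSpace X] {F : Set X}
    (hF : IsClosed F) (x : X) : IsClosed (connectedComponentIn F x) := by
  by_cases hx : x ∈ F
  · exact isClosed_of_closure_subset
      (isPreconnected_connectedComponentIn.closure.subset_connectedComponentIn
        (subset_closure (mem_connectedComponentIn hx))
        (closure_minimal (connectedComponentIn_subset F x) hF))
  · rw [connectedComponentIn_eq_empty hx]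
    exact isClosed_empty

theorem connectedComponentIn_compl_ball_subset_sComp {X : Type*} [MetricSpace X] [CompactSpace X]
    {p : X} {r : ℝ} (hr : 0 < r) (x : X) :
    connectedComponentIn (ball p r)ᶜ x ⊆ sComp p x := by
  intro y hy
  have hx : x ∈ (ball p r)ᶜ := connectedComponentIn_nonempty_iff.1 ⟨y, hy⟩
  refine ⟨_, ⟨(isClosed_connectedComponentIn isOpen_ball.isClosed_compl x).isCompact,
    isConnected_connectedComponentIn_iff.2 hx, mem_connectedComponentIn hx,
    (connectedComponentIn_subset _ _).trans (compl_subset_compl.2 ?_)⟩, hy⟩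
  simpa using hr

theorem exists_mem_connectedComponentIn_compl_ball {X : Type*} [MetricSpace X]
    {p x y : X} (h : y ∈ sComp p x) :
    ∃ n : ℕ, y ∈ connectedComponentIn (ball p (1 / ((n : ℝ) + 1)))ᶜ x := by
  obtain ⟨K, ⟨hKc, hK, hxK, hKp⟩, hyK⟩ := h
  obtain ⟨r, hr, hrK⟩ := Metric.isOpen_iff.1 hKc.isClosed.isOpen_compl p
    (fun hp => hKp hp rfl)
  obtain ⟨n, hn⟩ := exists_nat_one_div_lt hr
  exact ⟨n, hK.isPreconnected.subset_connectedComponentIn hxK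
    (subset_compl_comm.1 ((ball_subset_ball hn.le).trans hrK)) hyK⟩

/-- If every `sComp p x` is dense and there are only countably many of them, then Baire's theorem
provides one with nonempty interior, so that they all coincide. -/
theorem sComp_eq_of_countable {X : Type*} [MetricSpace X] [CompactSpace X] {p : X}
    (hp : interior ({p} : Set X) = ∅) (hd : ∀ x ≠ p, Dense (sComp p x))
    (hc : {S : Set X | ∃ x : X, x ≠ p ∧ S = sComp p x}.Countable)
    {x y : X} (hx : x ≠ p) (hy : y ≠ p) : sComp p x = sComp p y := by
  set F : Set (Set X) := {S | ∃ x : X, x ≠ p ∧ S = sComp p x}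
  have : Countable F := hc.to_subtype
  choose r hrp hr using fun S : F => S.2
  have : Nonempty X := ⟨p⟩
  let f : Option (F × ℕ) → Set X := fun o =>
    o.elim {p} fun q => connectedComponentIn (ball p (1 / ((q.2 : ℝ) + 1)))ᶜ (r q.1)
  have hf : ∀ o, IsClosed (f o) := by
    rintro (_ | q)
    · exact isClosed_singleton
    · exact isClosed_connectedComponentIn isOpen_ball.isClosed_compl _
  have hU : ⋃ o, f o = univ := by
    refine eq_univ_of_forall fun z => mem_iUnion.2 ?_
    by_cases hz : z = p
    · exact ⟨none, hz⟩
    · let S : F := ⟨sComp p z, z, hz, rfl⟩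
      have hzS : z ∈ sComp p (r S) := hr S ▸ mem_sComp_self hz
      obtain ⟨n, hn⟩ := exists_mem_connectedComponentIn_compl_ball hzS
      exact ⟨some (S, n), hn⟩
  obtain ⟨o, ho⟩ := nonempty_interior_of_iUnion_of_closed hf hU
  rcases o with _ | q
  · exact absurd hp ho.ne_empty
  · have key : ∀ z ≠ p, sComp p z = sComp p (r q.1) := fun z hz => by
      obtain ⟨w, hw, hwz⟩ := (hd z hz).inter_open_nonempty _ isOpen_interior ho
      exact (sComp_eq_of_mem hwz).symm.trans (sComp_eq_of_mem
        (connectedComponentIn_compl_ball_subset_sComp Nat.one_div_pos_of_nat _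
          (interior_subset hw)))
    rw [key x hx, key y hy]

theorem stmt16 (X : Type*) [MetricSpace X] [CompactSpace X] [ConnectedSpace X] [Nonempty X]
    (hNB : ∀ x : X, ({x} : Set X) ∈ NB X)
    (p : X) (hp : ({p} : Set X) ∉ NWC X) :
    (∀ x y : X, x ≠ p → y ≠ p → sComp p x = sComp p y ∨ sComp p x ∩ sComp p y = ∅) ∧
    (∀ x : X, x ≠ p → ∃ y : X, y ≠ p ∧ x ∈ sComp p y) ∧
    ¬ ({S : Set X | ∃ x : X, x ≠ p ∧ S = sComp p x}).Countable := by
  refine ⟨fun x y _ _ => sComp_eq_or_disjoint p x y, fun x hx => ⟨x, hx, mem_sComp_self hx⟩,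
    fun hc => hp ?_⟩
  obtain ⟨hne, hproper, hcl, hd⟩ := hNB p
  have : Nontrivial X := by
    obtain ⟨q, hq⟩ := (ne_univ_iff_exists_notMem _).1 hproper
    exact ⟨q, p, hq⟩
  have hint : interior ({p} : Set X) = ∅ := interior_singleton p
  refine ⟨hne, hproper, hcl, hint, fun x hx y hy => ?_⟩
  have hxy : y ∈ sComp p x :=
    sComp_eq_of_countable hint hd hc hy hx ▸ mem_sComp_self hy
  obtain ⟨K, ⟨hKc, hK, hxK, hKp⟩, hyK⟩ := hxy
  exact ⟨K, hKc, hK, hKp, hxK, hyK⟩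
end
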